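/- Let n ≥ 2. Every eigenvalue of the adjacency matrix of the Cayley graph G_n of 𝔖_n generated by the transpositions (1 i), 2 ≤ i ≤ n, lies in the set {−(n−1), −(n−2), …, n−2, n−1}. -/

import Mathlib

open Equiv Polynomial

/-- Adjacency matrix of the Cayley graph `G_n` of `𝔖_n = Perm (Fin n)` generated by the
transpositions `(1 i)` for `2 ≤ i ≤ n` (here `0 : Fin n` plays the role of the element `1`,
and the generators are `swap 0 i` for `i ≠ 0`). -/
noncomputable def adjMatn : (n : ℕ) → Matrix (Equiv.Perm (Fin n)) (Equiv.Perm (Fin n)) ℂ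
  | 0 => 0
  | m + 1 => fun σ τ =>
      if ∃ i : Fin (m + 1), i ≠ 0 ∧ τ * σ⁻¹ = Equiv.swap 0 i then 1 else 0

/-- If `Y = s X s + s` with `s` an involution and `X`, `Y` commuting endomorphisms, then every
eigenvalue of `Y` either is an eigenvalue of `X` or differs by `±1` from one. -/
theorem Module.End.HasEigenvalue.of_conj_involution_add {V : Type*} [AddCommGroup V] [Module ℂ V]
    [FiniteDimensional ℂ V] {X Y s : Module.End ℂ V} (hs : s * s = 1)
    (hY : Y = s * X * s + s) (hXY : Commute X Y) {b : ℂ} (hb : Y.HasEigenvalue b) :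
    X.HasEigenvalue b ∨ X.HasEigenvalue (b - 1) ∨ X.HasEigenvalue (b + 1) := by
  have hmap : Set.MapsTo X (Y.eigenspace b) (Y.eigenspace b) :=
    Module.End.mapsTo_genEigenspace_of_comm hXY.symm b 1
  have hnt : Nontrivial (Y.eigenspace b) := Submodule.nontrivial_iff_ne_bot.mpr hb
  obtain ⟨a, ha⟩ := Module.End.exists_eigenvalue (X.restrict hmap)
  obtain ⟨⟨v, hvY⟩, hv⟩ := ha.exists_hasEigenvector
  have hv0 : v ≠ 0 := fun h => hv.2 (Subtype.ext h)
  have hXv : X v = a • v := congrArg Subtype.val hv.apply_eq_smul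
  have hYv : Y v = b • v := Module.End.mem_eigenspace_iff.mp hvY
  have hXa : X.HasEigenvalue a :=
    Module.End.hasEigenvalue_of_hasEigenvector (Module.End.hasEigenvector_iff.mpr
      ⟨Module.End.mem_eigenspace_iff.mpr hXv, hv0⟩)
  have hss (w : V) : s (s w) = w := LinearMap.congr_fun hs w
  have hXs : X (s v) = b • s v - v := by
    have h := congrArg s hYv
    simp only [hY, LinearMap.add_apply, Module.End.mul_apply, map_add, map_smul, hss] at h
    exact eq_sub_of_add_eq h
  by_cases hw : (b - a) • s v - v = 0
  · have h1 : (b - a) • s v = v := sub_eq_zero.mp hw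
    have h2 : (b - a) • v = s v := by
      have h := congrArg s h1
      rwa [map_smul, hss] at h
    have h3 : ((b - a) * (b - a) - 1) • v = 0 := by
      rw [sub_smul, mul_smul, h2, h1, one_smul, sub_self]
    have h4 := (smul_eq_zero.mp h3).resolve_right hv0
    have h5 : (a - (b - 1)) * (a - (b + 1)) = 0 := by linear_combination h4
    rcases mul_eq_zero.mp h5 with h | h
    · exact Or.inr (Or.inl (sub_eq_zero.mp h ▸ hXa))
    · exact Or.inr (Or.inr (sub_eq_zero.mp h ▸ hXa))
  · refine Or.inl (Module.End.hasEigenvalue_of_hasEigenvector (Module.End.hasEigenvector_iff.mpr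
      ⟨Module.End.mem_eigenspace_iff.mpr ?_, hw⟩))
    rw [map_sub, map_smul, hXs, hXv]
    module

/-- The image of a Jucys–Murphy element (for the reversed order on `Fin n`) under a
representation of the symmetric group. -/
noncomputable def jucysMurphy {n : ℕ} {A : Type*} [Semiring A] (ρ : Perm (Fin n) →* A)
    (a : Fin n) : A :=
  ∑ i ∈ Finset.Ioi a, ρ (swap a i)

theorem commute_jucysMurphy {n : ℕ} {A : Type*} [Semiring A] (ρ : Perm (Fin n) →* A)
    {a : Fin n} {g : Perm (Fin n)} (hga : g a = a) (hg : ∀ i, a < i ↔ a < g i) :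
    Commute (ρ g) (jucysMurphy ρ a) := by
  rw [commute_iff_eq, jucysMurphy, Finset.mul_sum, Finset.sum_mul]
  refine Finset.sum_equiv g (by simpa using hg) fun i _ => ?_
  rw [← map_mul, ← map_mul, mul_swap_eq_swap_mul, hga]

theorem jucysMurphy_commute {n : ℕ} {A : Type*} [Semiring A] (ρ : Perm (Fin n) →* A)
    {a b : Fin n} (hab : a < b) : Commute (jucysMurphy ρ b) (jucysMurphy ρ a) := by
  refine Commute.sum_left _ _ _ fun j hj => ?_
  have hbj : b < j := Finset.mem_Ioi.mp hj
  have haj := hab.trans hbj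
  refine commute_jucysMurphy ρ (swap_apply_of_ne_of_ne hab.ne haj.ne) fun i => ?_
  rw [swap_apply_def]
  split_ifs with h1 h2 <;> simp_all

theorem jucysMurphy_castSucc {m : ℕ} {A : Type*} [Semiring A] (ρ : Perm (Fin (m + 1)) →* A)
    (i : Fin m) :
    jucysMurphy ρ i.castSucc =
      ρ (swap i.castSucc i.succ) * jucysMurphy ρ i.succ * ρ (swap i.castSucc i.succ) +
        ρ (swap i.castSucc i.succ) := by
  have hI : Finset.Ioi i.castSucc = insert i.succ (Finset.Ioi i.succ) := by
    ext j
    simp only [Finset.mem_Ioi, Finset.mem_insert, Fin.lt_def, Fin.ext_iff, Fin.val_succ,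
      Fin.val_castSucc]
    omega
  rw [jucysMurphy, hI, Finset.sum_insert (by simp), add_comm, jucysMurphy, Finset.mul_sum,
    Finset.sum_mul]
  congr 1
  refine Finset.sum_congr rfl fun j hj => ?_
  have hj : i.succ < j := Finset.mem_Ioi.mp hj
  have hij : i.castSucc < j := Fin.castSucc_lt_succ.trans hj
  rw [← map_mul, ← map_mul, mul_swap_eq_swap_mul _ i.succ j, swap_apply_right,
    swap_apply_of_ne_of_ne hij.ne' hj.ne', mul_assoc, swap_mul_self, mul_one]

theorem jucysMurphy_eigenvalue {m : ℕ} {V : Type*} [AddCommGroup V] [Module ℂ V]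
    [FiniteDimensional ℂ V] (ρ : Perm (Fin (m + 1)) →* Module.End ℂ V) (a : Fin (m + 1)) :
    ∀ μ : ℂ, (jucysMurphy ρ a).HasEigenvalue μ →
      ∃ k : ℤ, |k| ≤ (m : ℤ) - (a : ℕ) ∧ μ = (k : ℂ) := by
  induction a using Fin.reverseInduction with
  | last =>
    intro μ hμ
    obtain ⟨v, hv⟩ := hμ.exists_hasEigenvector
    have h := hv.apply_eq_smul
    have h0 : jucysMurphy ρ (Fin.last m) = 0 :=
      Finset.sum_eq_zero fun j hj => absurd (Finset.mem_Ioi.mp hj) (Fin.le_last j).not_gt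
    rw [h0, LinearMap.zero_apply] at h
    exact ⟨0, by simp, by simpa [hv.2] using h.symm⟩
  | cast i ih =>
    intro μ hμ
    have hs : ρ (swap i.castSucc i.succ) * ρ (swap i.castSucc i.succ) = 1 := by
      rw [← map_mul, swap_mul_self, map_one]
    simp only [abs_le, Fin.val_succ, Fin.val_castSucc] at ih ⊢
    push_cast at ih
    rcases hμ.of_conj_involution_add hs (jucysMurphy_castSucc ρ i)
      (jucysMurphy_commute ρ Fin.castSucc_lt_succ) with h | h | h
    · obtain ⟨k, hk, rfl⟩ := ih _ h
      exact ⟨k, by omega, rfl⟩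
    · obtain ⟨k, hk, e⟩ := ih _ h
      exact ⟨k + 1, by omega, by push_cast; linear_combination e⟩
    · obtain ⟨k, hk, e⟩ := ih _ h
      exact ⟨k - 1, by omega, by push_cast; linear_combination e⟩

/-- The left regular representation of a group on the complex-valued functions on it. -/
def leftRegularFun (G : Type*) [Group G] : G →* Module.End ℂ (G → ℂ) where
  toFun g := LinearMap.funLeft ℂ ℂ fun x => g⁻¹ * x
  map_one' := by ext; simp [LinearMap.funLeft]
  map_mul' g h := by
    refine LinearMap.ext fun v => funext fun x => ?_
    simp [LinearMap.funLeft_apply, mul_assoc]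

theorem toLin'_adjMatn_succ (m : ℕ) :
    Matrix.toLin' (adjMatn (m + 1)) = jucysMurphy (leftRegularFun (Perm (Fin (m + 1)))) 0 := by
  refine LinearMap.ext fun v => funext fun σ => ?_
  have hL : Matrix.toLin' (adjMatn (m + 1)) v σ =
      ∑ τ with ∃ i : Fin (m + 1), i ≠ 0 ∧ τ * σ⁻¹ = swap 0 i, v τ := by
    rw [Matrix.toLin'_apply, Finset.sum_filter]
    simp [Matrix.mulVec, dotProduct, adjMatn]
  have hR : jucysMurphy (leftRegularFun (Perm (Fin (m + 1)))) 0 v σ =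
      ∑ i ∈ Finset.Ioi 0, v (swap 0 i * σ) := by
    simp [jucysMurphy, leftRegularFun, LinearMap.sum_apply, Finset.sum_apply,
      LinearMap.funLeft_apply]
  rw [hL, hR]
  symm
  refine Finset.sum_bij (fun i _ => swap 0 i * σ) (fun i hi => ?_) (fun i _ j _ h => ?_)
    (fun τ hτ => ?_) fun _ _ => rfl
  · simpa using ⟨i, (Finset.mem_Ioi.mp hi).ne', rfl⟩
  · simpa using Equiv.congr_fun (mul_right_cancel h) 0
  · obtain ⟨i, hi, h⟩ := (Finset.mem_filter.mp hτ).2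
    exact ⟨i, Finset.mem_Ioi.mpr (Fin.pos_iff_ne_zero.mpr hi), (mul_inv_eq_iff_eq_mul.mp h).symm⟩

/-- Every eigenvalue of the adjacency matrix of `G_n` lies in `{−(n−1), …, n−1}`. -/
theorem cayley_spectrum_bounded (n : ℕ) (hn : 2 ≤ n) :
    ∀ μ ∈ (adjMatn n).charpoly.roots,
      ∃ k : ℤ, -((n : ℤ) - 1) ≤ k ∧ k ≤ (n : ℤ) - 1 ∧ μ = (k : ℂ) := by
  intro μ hμ
  obtain ⟨m, rfl⟩ : ∃ m, n = m + 1 := ⟨n - 1, by omega⟩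
  have hroot := Polynomial.isRoot_of_mem_roots hμ
  rw [← Matrix.charpoly_toLin', ← Module.End.hasEigenvalue_iff_isRoot_charpoly,
    toLin'_adjMatn_succ] at hroot
  obtain ⟨k, hk, rfl⟩ := jucysMurphy_eigenvalue _ _ μ hroot
  rw [abs_le, Fin.val_zero] at hk
  exact ⟨k, by omega, by omega, rfl⟩
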